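/- Let Λ be the preprojective algebra of type D_4 (central vertex 2, outer vertices 1, 3, 4), T = S_2 ⊕ S_2, and T' = X ⊕ S_2 where X is the unique nonsplit extension of S_1 by S_2 (socle S_2, top S_1). Let γ_0 = −s_1s_2s_4s_3s_2 ϖ_2, so ⟨h_1, γ_0⟩ = 2, with N(γ_0) the 6-dimensional module with dimension vector α_1+2α_2+α_3+α_4+α_1... (dim vector 2α_1 + 2α_2 + α_3 + α_4) and N(s_1γ_0) with dimension vector α_1 + 2α_2 + α_3 + α_4 minus α_1 appropriately (dim vector 2α_2 + α_3 + α_4). Then dim Hom_Λ(N(γ_0), T) = 0, dim Hom_Λ(N(s_1γ_0), T) = 2, and dim Hom_Λ(N(γ_0), T') = 1; in particular −dim Hom_Λ(N(γ_0), T') ≠ min{−dim Hom_Λ(N(γ_0),T), −dim Hom_Λ(N(s_1γ_0),T) + c·2} where c = 1. -/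

import Mathlib

noncomputable section
open Module

/-! The preprojective algebra `Λ = Λ(Q)` of a quiver `Q` whose underlying graph is a
(simply-laced) Dynkin diagram with Cartan matrix `C`, constructed as the quotient of the
path algebra of the double quiver `Q̄` (realized inside the free algebra on the vertex
idempotents and the arrows) by the preprojective relations `∑_a ε(a) a a* = 0`.
`sgn i j` is the sign `ε` of the arrow `i → j` of `Q̄` (`+1` on `Ω`, `−1` on `Ω*`). -/

/-- Generators of the path algebra of the double quiver: one idempotent per vertex and
one arrow `i → j` for every pair of adjacent vertices `i, j`. -/
inductive PGen (I : Type) : Type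
  | idem : I → PGen I
  | arrow : I → I → PGen I

variable {I : Type} [Fintype I] [DecidableEq I]

open PGen in
/-- The defining relations of the preprojective algebra: the path-algebra relations for
the idempotents and arrows of the double quiver of the graph of `C` (the generator
`arrow i j` is set to `0` when `i` and `j` are not adjacent), and the preprojective
relations `∑_{a : t(a) = i} ε(a) a a* = 0`. -/
inductive PRel (C : I → I → ℤ) (sgn : I → I → ℤ) :
    FreeAlgebra ℂ (PGen I) → FreeAlgebra ℂ (PGen I) → Prop
  | idem_mul (i j : I) :
      PRel C sgn (FreeAlgebra.ι ℂ (idem i) * FreeAlgebra.ι ℂ (idem j))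
        (if i = j then FreeAlgebra.ι ℂ (idem i) else 0)
  | idem_sum : PRel C sgn (∑ i : I, FreeAlgebra.ι ℂ (idem i)) 1
  | arrow_src (i j : I) :
      PRel C sgn (FreeAlgebra.ι ℂ (arrow i j) * FreeAlgebra.ι ℂ (idem i))
        (FreeAlgebra.ι ℂ (arrow i j))
  | arrow_tgt (i j : I) :
      PRel C sgn (FreeAlgebra.ι ℂ (idem j) * FreeAlgebra.ι ℂ (arrow i j))
        (FreeAlgebra.ι ℂ (arrow i j))
  | arrow_zero (i j : I) (h : C i j ≠ -1) :
      PRel C sgn (FreeAlgebra.ι ℂ (arrow i j)) 0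
  | preproj (i : I) :
      PRel C sgn
        (∑ j : I, sgn j i • (FreeAlgebra.ι ℂ (arrow j i) * FreeAlgebra.ι ℂ (arrow i j))) 0

/-- The preprojective algebra of the graph of `C` (with signs `sgn`). -/
def PreprojAlg (C : I → I → ℤ) (sgn : I → I → ℤ) : Type := RingQuot (PRel C sgn)

instance (C sgn : I → I → ℤ) : Ring (PreprojAlg C sgn) :=
  inferInstanceAs (Ring (RingQuot (PRel C sgn)))
instance (C sgn : I → I → ℤ) : Algebra ℂ (PreprojAlg C sgn) :=
  inferInstanceAs (Algebra ℂ (RingQuot (PRel C sgn)))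

/-- The vertex idempotent `e_i ∈ Λ`. -/
def pe (C sgn : I → I → ℤ) (i : I) : PreprojAlg C sgn :=
  RingQuot.mkRingHom (PRel C sgn) (FreeAlgebra.ι ℂ (PGen.idem i))

/-- The ℂ-linear action of the idempotent `e_i` on a `Λ`-module `X`. -/
def smulIdem (C sgn : I → I → ℤ) (X : Type) [AddCommGroup X] [Module ℂ X]
    [Module (PreprojAlg C sgn) X] [SMulCommClass (PreprojAlg C sgn) ℂ X] (i : I) :
    X →ₗ[ℂ] X where
  toFun x := pe C sgn i • x
  map_add' x y := smul_add _ x y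
  map_smul' c x := smul_comm _ c x

/-- The dimension vector of a `Λ`-module `X`: `(dim X)_i = dim_ℂ (e_i X)`. -/
def dimv (C sgn : I → I → ℤ) (X : Type) [AddCommGroup X] [Module ℂ X]
    [Module (PreprojAlg C sgn) X] [SMulCommClass (PreprojAlg C sgn) ℂ X] (i : I) : ℕ :=
  finrank ℂ (LinearMap.range (smulIdem C sgn X i))

/-- Composition with `ι` as a ℂ-linear map between `Λ`-homomorphism spaces. -/
def precomp {Λ : Type} [Ring Λ] {K P M : Type}
    [AddCommGroup K] [Module Λ K] [AddCommGroup P] [Module Λ P]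
    [AddCommGroup M] [Module Λ M] [Module ℂ M] [SMulCommClass Λ ℂ M]
    (ι : K →ₗ[Λ] P) : (P →ₗ[Λ] M) →ₗ[ℂ] (K →ₗ[Λ] M) where
  toFun g := g.comp ι
  map_add' g h := by ext x; simp
  map_smul' c g := by ext x; simp

/-- `dim Ext¹_Λ(C, M)` computed from a projective presentation `0 → K → P → C → 0` of
`C`: the dimension of the cokernel of `Hom_Λ(P,M) → Hom_Λ(K,M)`. -/
def ext1dim {Λ : Type} [Ring Λ] {K P : Type}
    [AddCommGroup K] [Module Λ K] [AddCommGroup P] [Module Λ P]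
    (ι : K →ₗ[Λ] P) (M : Type)
    [AddCommGroup M] [Module Λ M] [Module ℂ M] [SMulCommClass Λ ℂ M] : ℕ :=
  finrank ℂ ((K →ₗ[Λ] M) ⧸ LinearMap.range (precomp (M := M) ι))

/-- The Cartan matrix of type `D₄` with vertices `0,1,2,3` (the paper's labels
`1,2,3,4`), the central vertex being `1` (the paper's label `2`). -/
def cartanD4 (i j : Fin 4) : ℤ :=
  if i = j then 2 else if i = 1 ∨ j = 1 then -1 else 0

section Generators

variable (C sgn : I → I → ℤ)

/-- The arrow `i → j` as an element of the preprojective algebra. -/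
def pa (i j : I) : PreprojAlg C sgn :=
  RingQuot.mkRingHom (PRel C sgn) (FreeAlgebra.ι ℂ (PGen.arrow i j))

/-- The quotient map onto the preprojective algebra. -/
def pmk : FreeAlgebra ℂ (PGen I) →+* PreprojAlg C sgn :=
  RingQuot.mkRingHom (PRel C sgn)

variable {C sgn}

theorem pmk_rel {x y : FreeAlgebra ℂ (PGen I)} (h : PRel C sgn x y) :
    pmk C sgn x = pmk C sgn y :=
  RingQuot.mkRingHom_rel h

theorem pmk_algebraMap (c : ℂ) :
    pmk C sgn (algebraMap ℂ _ c) = algebraMap ℂ (PreprojAlg C sgn) c := by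
  have h := (RingQuot.mkAlgHom ℂ (PRel C sgn)).commutes c
  exact (RingHom.congr_fun (RingQuot.mkAlgHom_coe ℂ (PRel C sgn)) _).symm.trans h

theorem pe_mul_pe (i j : I) :
    pe C sgn i * pe C sgn j = if i = j then pe C sgn i else 0 := by
  have h := pmk_rel (PRel.idem_mul (C := C) (sgn := sgn) i j)
  rw [map_mul] at h
  split_ifs at h ⊢ with hij
  · exact h
  · exact h.trans (map_zero _)

theorem sum_pe : ∑ i : I, pe C sgn i = 1 := by
  have h := pmk_rel (PRel.idem_sum (C := C) (sgn := sgn))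
  rw [map_sum, map_one] at h
  exact h

theorem pa_mul_pe (i j : I) : pa C sgn i j * pe C sgn i = pa C sgn i j := by
  have h := pmk_rel (PRel.arrow_src (C := C) (sgn := sgn) i j)
  rw [map_mul] at h
  exact h

theorem pe_mul_pa (i j : I) : pe C sgn j * pa C sgn i j = pa C sgn i j := by
  have h := pmk_rel (PRel.arrow_tgt (C := C) (sgn := sgn) i j)
  rw [map_mul] at h
  exact h

theorem pa_eq_zero {i j : I} (hij : C i j ≠ -1) : pa C sgn i j = 0 :=
  (pmk_rel (PRel.arrow_zero (C := C) (sgn := sgn) i j hij)).trans (map_zero _)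

theorem sum_pa_mul_pa (i : I) :
    ∑ j : I, sgn j i • (pa C sgn j i * pa C sgn i j) = 0 := by
  have h := pmk_rel (PRel.preproj (C := C) (sgn := sgn) i)
  simp only [map_sum, map_zsmul, map_mul, map_zero] at h
  exact h

theorem pa_mul_pe_of_ne {i j k : I} (h : k ≠ i) : pa C sgn i j * pe C sgn k = 0 := by
  rw [← pa_mul_pe, mul_assoc, pe_mul_pe, if_neg h.symm, mul_zero]

theorem pe_mul_pa_of_ne {i j k : I} (h : k ≠ j) : pe C sgn k * pa C sgn i j = 0 := by
  rw [← pe_mul_pa, ← mul_assoc, pe_mul_pe, if_neg h, zero_mul]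

theorem pa_mul_pa_of_ne {i j k l : I} (h : l ≠ i) :
    pa C sgn i j * pa C sgn k l = 0 := by
  rw [← pe_mul_pa k l, ← mul_assoc, pa_mul_pe_of_ne h, zero_mul]

theorem PreprojAlg.induction {p : PreprojAlg C sgn → Prop}
    (hc : ∀ c : ℂ, p (algebraMap ℂ _ c)) (he : ∀ i, p (pe C sgn i))
    (ha : ∀ i j, p (pa C sgn i j)) (hadd : ∀ a b, p a → p b → p (a + b))
    (hmul : ∀ a b, p a → p b → p (a * b)) (a : PreprojAlg C sgn) : p a := by
  obtain ⟨x, rfl⟩ : ∃ x, pmk C sgn x = a := RingQuot.mkRingHom_surjective _ a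
  induction x using FreeAlgebra.induction with
  | grade0 c => rw [pmk_algebraMap]; exact hc c
  | grade1 g =>
    cases g with
    | idem i => exact he i
    | arrow i j => exact ha i j
  | mul x y hx hy => rw [map_mul]; exact hmul _ _ hx hy
  | add x y hx hy => rw [map_add]; exact hadd _ _ hx hy

section Modules

variable {M N : Type} [AddCommGroup M] [Module (PreprojAlg C sgn) M]
  [AddCommGroup N] [Module (PreprojAlg C sgn) N]

theorem sum_pe_smul (x : M) : ∑ i : I, pe C sgn i • x = x := by
  rw [← Finset.sum_smul, sum_pe, one_smul]

theorem hom_eq_zero_of_pe (f : M →ₗ[PreprojAlg C sgn] N)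
    (h : ∀ i x, pe C sgn i • x = x → f x = 0) : f = 0 := by
  ext x
  rw [← sum_pe_smul (C := C) (sgn := sgn) x, map_sum]
  refine Finset.sum_eq_zero fun i _ => h i _ ?_
  rw [smul_smul, pe_mul_pe, if_pos rfl]

theorem mem_range_smulIdem [Module ℂ M] [SMulCommClass (PreprojAlg C sgn) ℂ M]
    {i : I} {x : M} :
    x ∈ LinearMap.range (smulIdem C sgn M i) ↔ pe C sgn i • x = x := by
  constructor
  · rintro ⟨y, rfl⟩
    change pe C sgn i • pe C sgn i • y = pe C sgn i • y
    rw [smul_smul, pe_mul_pe, if_pos rfl]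
  · exact fun h => ⟨x, h⟩

/-- Multiplication by an arrow as a linear map between vertex spaces. -/
def arrowMap [Module ℂ M] [SMulCommClass (PreprojAlg C sgn) ℂ M] (i j : I) :
    LinearMap.range (smulIdem C sgn M i) →ₗ[ℂ] LinearMap.range (smulIdem C sgn M j) where
  toFun x := ⟨pa C sgn i j • (x : M),
    mem_range_smulIdem.2 (by rw [smul_smul, pe_mul_pa])⟩
  map_add' x y := Subtype.ext (smul_add _ _ _)
  map_smul' c x := Subtype.ext (smul_comm _ c _)

variable [Module ℂ M] [IsScalarTower ℂ (PreprojAlg C sgn) M]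
  [Module ℂ N] [IsScalarTower ℂ (PreprojAlg C sgn) N]

/-- A `ℂ`-linear map commuting with the idempotents and the arrows is `Λ`-linear. -/
def homOfGenerators (f : M →ₗ[ℂ] N)
    (he : ∀ i x, f (pe C sgn i • x) = pe C sgn i • f x)
    (ha : ∀ i j x, f (pa C sgn i j • x) = pa C sgn i j • f x) :
    M →ₗ[PreprojAlg C sgn] N where
  toFun := f
  map_add' := map_add f
  map_smul' a := by
    induction a using PreprojAlg.induction with
    | hc c => intro x; simp
    | he i => exact he i
    | ha i j => exact ha i j
    | hadd a b ha hb => intro x; simp_all [add_smul]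
    | hmul a b ha hb => intro x; simp_all [mul_smul]

theorem hom_map_smul_complex (f : M →ₗ[PreprojAlg C sgn] N) (c : ℂ) (x : M) :
    f (c • x) = c • f x := by
  rw [← algebraMap_smul (PreprojAlg C sgn) c x, map_smul, algebraMap_smul]

theorem smul_mem_span_of_pa_smul_eq_zero {i : I} {y : M} (hy : pe C sgn i • y = y)
    (h : ∀ k l, pa C sgn k l • y = 0) (a : PreprojAlg C sgn) : ∃ c : ℂ, a • y = c • y := by
  induction a using PreprojAlg.induction with
  | hc c => exact ⟨c, algebraMap_smul _ c y⟩
  | he j =>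
    refine ⟨if j = i then 1 else 0, ?_⟩
    rw [← hy, smul_smul, pe_mul_pe]
    split_ifs with hij
    · rw [hij, one_smul]
    · rw [zero_smul, zero_smul]
  | ha k l => exact ⟨0, by rw [h, zero_smul]⟩
  | hadd a b ha hb =>
    obtain ⟨c, hc⟩ := ha
    obtain ⟨d, hd⟩ := hb
    exact ⟨c + d, by rw [add_smul, hc, hd, add_smul]⟩
  | hmul a b ha hb =>
    obtain ⟨c, hc⟩ := ha
    obtain ⟨d, hd⟩ := hb
    refine ⟨d * c, ?_⟩
    rw [mul_smul, hd, ← algebraMap_smul (PreprojAlg C sgn) d y, smul_smul,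
      ← Algebra.commutes, mul_smul, hc, algebraMap_smul, mul_smul]

end Modules

end Generators

section D4

local notation "Λ₄" => PreprojAlg cartanD4
local notation "𝖾" => pe cartanD4
local notation "𝖺" => pa cartanD4

variable {sgn : Fin 4 → Fin 4 → ℤ}


theorem pa_eq_zero_of_ne_one {i j : Fin 4} (hi : i ≠ 1) (hj : j ≠ 1) : 𝖺 sgn i j = 0 := by
  refine pa_eq_zero ?_
  unfold cartanD4
  split_ifs <;> simp_all

theorem pa_one_one : 𝖺 sgn 1 1 = 0 := pa_eq_zero (by decide)

theorem arrow_sign_ne_zero (hsgn : ∀ i j, cartanD4 i j = -1 →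
      sgn i j * sgn j i = -1 ∧ (sgn i j = 1 ∨ sgn i j = -1)) {i j : Fin 4}
    (h : cartanD4 i j = -1) : sgn i j ≠ 0 := by
  rcases (hsgn i j h).2 with h | h <;> rw [h] <;> decide

theorem zsmul_smul_eq_complex_smul {M : Type} [AddCommGroup M] [Module ℂ M] [Module (Λ₄ sgn) M]
    (n : ℤ) (b : Λ₄ sgn) (y : M) : (n • b) • y = (n : ℂ) • (b • y) := by
  rw [smul_assoc, Int.cast_smul_eq_zsmul]

theorem pa_one_mul_pa (hsgn : ∀ i j, cartanD4 i j = -1 →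
      sgn i j * sgn j i = -1 ∧ (sgn i j = 1 ∨ sgn i j = -1)) {i : Fin 4} (hi : i ≠ 1) :
    𝖺 sgn 1 i * 𝖺 sgn i 1 = 0 := by
  have h := sum_pa_mul_pa (C := cartanD4) (sgn := sgn) i
  rw [Finset.sum_eq_single 1 (fun j _ hj => by
    rw [pa_eq_zero_of_ne_one hj hi, zero_mul, smul_zero]) (by simp)] at h
  have hc : cartanD4 1 i = -1 := by simp [cartanD4, hi.symm]
  rcases (hsgn 1 i hc).2 with h1 | h1 <;> simpa [h1] using h

/-- The socle of `M` is zero or the simple module at the central vertex, expressed in terms of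
the action of the arrows. -/
structure HasCentralSocle (M : Type) [AddCommGroup M] [Module ℂ M] [Module (Λ₄ sgn) M] : Prop where
  eq_zero_of_pa_smul : ∀ j ≠ 1, ∀ y : M, 𝖾 sgn j • y = y → 𝖺 sgn j 1 • y = 0 → y = 0
  exists_smul_eq : ∀ y z : M, 𝖾 sgn 1 • y = y → 𝖾 sgn 1 • z = z → (∀ j, 𝖺 sgn 1 j • y = 0) →
    (∀ j, 𝖺 sgn 1 j • z = 0) → z ≠ 0 → ∃ c : ℂ, y = c • z

theorem exists_smul_eq_of_finrank_one {M : Type} [AddCommGroup M] [Module ℂ M]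
    [Module (Λ₄ sgn) M] [SMulCommClass (Λ₄ sgn) ℂ M] {i : Fin 4} (h : dimv cartanD4 sgn M i = 1)
    {y z : M} (hy : 𝖾 sgn i • y = y) (hz : 𝖾 sgn i • z = z) (hz0 : z ≠ 0) : ∃ c : ℂ, y = c • z := by
  obtain ⟨c, hc⟩ := (finrank_eq_one_iff_of_nonzero'
    (⟨z, mem_range_smulIdem.2 hz⟩ : LinearMap.range (smulIdem cartanD4 sgn M i))
    (fun h => hz0 (congrArg Subtype.val h))).1 h ⟨y, mem_range_smulIdem.2 hy⟩
  exact ⟨c, (congrArg Subtype.val hc).symm⟩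

section Socle

variable {S M J : Type}
  [AddCommGroup S] [Module ℂ S] [Module (Λ₄ sgn) S] [IsScalarTower ℂ (Λ₄ sgn) S]
  [AddCommGroup M] [Module ℂ M] [Module (Λ₄ sgn) M] [IsScalarTower ℂ (Λ₄ sgn) M]
  [AddCommGroup J] [Module ℂ J] [Module (Λ₄ sgn) J] [IsScalarTower ℂ (Λ₄ sgn) J]

theorem hasCentralSocle_of_injective (hS : finrank ℂ S = 1) (hS1 : ∀ x : S, 𝖾 sgn 1 • x = x)
    (ιS : S →ₗ[Λ₄ sgn] J)
    (hess : ∀ y : J, y ≠ 0 → ∃ b : Λ₄ sgn, b • y ≠ 0 ∧ b • y ∈ LinearMap.range ιS)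
    (ι : M →ₗ[Λ₄ sgn] J) (hι : Function.Injective ι) : HasCentralSocle (sgn := sgn) M := by
  have key : ∀ (i : Fin 4) (y : M), 𝖾 sgn i • y = y → (∀ k l, 𝖺 sgn k l • y = 0) →
      ι y ∈ LinearMap.range ιS := by
    intro i y hy h
    by_cases hy0 : y = 0
    · rw [hy0, map_zero]; exact zero_mem _
    obtain ⟨b, hb, s, hs⟩ := hess (ι y) (fun h0 => hy0 (hι (h0.trans (map_zero ι).symm)))
    obtain ⟨c, hc⟩ := smul_mem_span_of_pa_smul_eq_zero hy h b
    rw [← map_smul, hc, hom_map_smul_complex] at hb hs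
    have hc0 : c ≠ 0 := fun h0 => hb (by rw [h0, zero_smul])
    exact ⟨c⁻¹ • s, by rw [hom_map_smul_complex, hs, inv_smul_smul₀ hc0]⟩
  constructor
  · intro j hj y hy h
    obtain ⟨s, hs⟩ := key j y hy (fun k l => by
      by_cases hk : k = j
      · subst hk
        by_cases hl : l = 1
        · rw [hl, h]
        · rw [pa_eq_zero_of_ne_one hj hl, zero_smul]
      · rw [← hy, smul_smul, pa_mul_pe_of_ne (Ne.symm hk), zero_smul])
    have h1 : 𝖾 sgn 1 • y = y := hι (by rw [map_smul, ← hs, ← map_smul, hS1])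
    rw [← hy, ← h1, smul_smul, pe_mul_pe, if_neg hj, zero_smul]
  · intro y z hy hz hay haz hz0
    have aux : ∀ w : M, 𝖾 sgn 1 • w = w → (∀ j, 𝖺 sgn 1 j • w = 0) → ∀ k l, 𝖺 sgn k l • w = 0 := by
      intro w hw haw k l
      by_cases hk : k = 1
      · rw [hk, haw]
      · rw [← hw, smul_smul, pa_mul_pe_of_ne (Ne.symm hk), zero_smul]
    obtain ⟨s, hs⟩ := key 1 y hy (aux y hy hay)
    obtain ⟨t, ht⟩ := key 1 z hz (aux z hz haz)
    have ht0 : t ≠ 0 := fun h0 => hz0 (hι (by rw [← ht, h0, map_zero, map_zero]))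
    obtain ⟨c, hc⟩ := (finrank_eq_one_iff_of_nonzero' t ht0).1 hS s
    exact ⟨c, hι (by rw [hom_map_smul_complex, ← hs, ← ht, ← hc, hom_map_smul_complex])⟩

end Socle

section Structure

variable {M : Type} [AddCommGroup M] [Module ℂ M] [Module (Λ₄ sgn) M] [SMulCommClass (Λ₄ sgn) ℂ M]

theorem HasCentralSocle.arrowMap_injective (hM : HasCentralSocle (sgn := sgn) M) {j : Fin 4}
    (hj : j ≠ 1) : Function.Injective (arrowMap (C := cartanD4) (sgn := sgn) (M := M) j 1) := by
  refine (injective_iff_map_eq_zero _).2 fun y hy => Subtype.ext ?_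
  exact hM.eq_zero_of_pa_smul j hj y (mem_range_smulIdem.1 y.2) (congrArg Subtype.val hy)

theorem finiteDimensional_vertex_one (h1 : dimv cartanD4 sgn M 1 = 2) :
    FiniteDimensional ℂ (LinearMap.range (smulIdem cartanD4 sgn M 1)) :=
  FiniteDimensional.of_finrank_pos (by
    change 0 < dimv cartanD4 sgn M 1
    omega)

theorem HasCentralSocle.pe_zero_smul_eq_zero (hM : HasCentralSocle (sgn := sgn) M)
    (h1 : dimv cartanD4 sgn M 1 = 2) (h0 : dimv cartanD4 sgn M 0 = 0) {y : M}
    (hy : 𝖾 sgn 0 • y = y) : y = 0 := by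
  have := finiteDimensional_vertex_one h1
  have := FiniteDimensional.of_injective _ (hM.arrowMap_injective (j := 0) (by decide))
  have hs := finrank_zero_iff.1 (show finrank ℂ (LinearMap.range (smulIdem cartanD4 sgn M 0)) = 0
    from h0)
  exact congrArg Subtype.val (hs.elim ⟨y, mem_range_smulIdem.2 hy⟩ 0)

theorem HasCentralSocle.exists_pa_zero_one_smul (hM : HasCentralSocle (sgn := sgn) M)
    (h1 : dimv cartanD4 sgn M 1 = 2) (h0 : dimv cartanD4 sgn M 0 = 2) {y : M}
    (hy : 𝖾 sgn 1 • y = y) : ∃ u : M, 𝖾 sgn 0 • u = u ∧ 𝖺 sgn 0 1 • u = y := by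
  have := finiteDimensional_vertex_one h1
  have hinj := hM.arrowMap_injective (j := 0) (by decide)
  have := FiniteDimensional.of_injective _ hinj
  obtain ⟨u, hu⟩ := (LinearMap.injective_iff_surjective_of_finrank_eq_finrank
    (h0.trans h1.symm)).1 hinj ⟨y, mem_range_smulIdem.2 hy⟩
  exact ⟨u, mem_range_smulIdem.1 u.2, congrArg Subtype.val hu⟩

/-- The common features of `N(γ₀)` and `N(s₁γ₀)`: the kernel of the arrow `1 → 2` on the vertex
space at `1` is the image of the arrow `2 → 1` and contains the image of the arrow `3 → 1`. -/
theorem HasCentralSocle.exists_generator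
    (hsgn : ∀ i j, cartanD4 i j = -1 →
      sgn i j * sgn j i = -1 ∧ (sgn i j = 1 ∨ sgn i j = -1))
    (hM : HasCentralSocle (sgn := sgn) M) (h1 : dimv cartanD4 sgn M 1 = 2)
    (hα : ∀ y : M, 𝖺 sgn 1 0 • y = 0) :
    ∃ v : M, 𝖾 sgn 1 • v = v ∧ 𝖺 sgn 1 2 • v ≠ 0 ∧
      (∀ y : M, 𝖾 sgn 1 • y = y → 𝖺 sgn 1 2 • y = 0 → ∃ u : M, y = 𝖺 sgn 2 1 • u) ∧
      ∀ u : M, 𝖺 sgn 1 2 • 𝖺 sgn 3 1 • u = 0 := by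
  have hβα : ∀ y : M, (sgn 2 1 : ℂ) • (𝖺 sgn 2 1 • 𝖺 sgn 1 2 • y) +
      (sgn 3 1 : ℂ) • (𝖺 sgn 3 1 • 𝖺 sgn 1 3 • y) = 0 := by
    intro y
    have h := congrArg (fun b : Λ₄ sgn => b • y) (sum_pa_mul_pa (C := cartanD4) (sgn := sgn) 1)
    simpa only [Fin.sum_univ_four, add_smul, zsmul_smul_eq_complex_smul, mul_smul, hα,
      pa_one_one, smul_zero, zero_smul, zero_add] using h
  have hs2 : (sgn 2 1 : ℂ) ≠ 0 := Int.cast_ne_zero.2 (arrow_sign_ne_zero hsgn (by decide))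
  have hs3 : (sgn 3 1 : ℂ) ≠ 0 := Int.cast_ne_zero.2 (arrow_sign_ne_zero hsgn (by decide))
  have he : ∀ (i j : Fin 4) (y : M), 𝖾 sgn j • 𝖺 sgn i j • y = 𝖺 sgn i j • y := fun i j y => by
    rw [smul_smul, pe_mul_pa]
  have h23 : ∀ y : M, 𝖺 sgn 1 2 • y = 0 → 𝖺 sgn 1 3 • y = 0 := by
    intro y hy
    have h := hβα y
    rw [hy, smul_zero, smul_zero, zero_add, smul_eq_zero_iff_right hs3] at h
    exact hM.eq_zero_of_pa_smul 3 (by decide) _ (he _ _ _) h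
  have h32 : ∀ y : M, 𝖺 sgn 1 3 • y = 0 → 𝖺 sgn 1 2 • y = 0 := by
    intro y hy
    have h := hβα y
    rw [hy, smul_zero, smul_zero, add_zero, smul_eq_zero_iff_right hs2] at h
    exact hM.eq_zero_of_pa_smul 2 (by decide) _ (he _ _ _) h
  have hker : ∀ y z : M, 𝖾 sgn 1 • y = y → 𝖾 sgn 1 • z = z → 𝖺 sgn 1 2 • y = 0 → 𝖺 sgn 1 2 • z = 0 →
      z ≠ 0 → ∃ c : ℂ, y = c • z := by
    have aux : ∀ y : M, 𝖺 sgn 1 2 • y = 0 → ∀ j, 𝖺 sgn 1 j • y = 0 := by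
      intro y hy j
      fin_cases j
      · exact hα y
      · exact (congrArg (· • y) pa_one_one).trans (zero_smul _ y)
      · exact hy
      · exact h23 y hy
    exact fun y z hy hz hay haz => hM.exists_smul_eq y z hy hz (aux y hay) (aux z haz)
  obtain ⟨v, hv, hv2⟩ : ∃ v : M, 𝖾 sgn 1 • v = v ∧ 𝖺 sgn 1 2 • v ≠ 0 := by
    by_contra! hcon
    have hfr : finrank ℂ (LinearMap.range (smulIdem cartanD4 sgn M 1)) ≤ 1 := by
      by_cases hz : ∃ z : M, 𝖾 sgn 1 • z = z ∧ z ≠ 0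
      · obtain ⟨z, hz, hz0⟩ := hz
        refine finrank_le_one ⟨z, mem_range_smulIdem.2 hz⟩ fun y => ?_
        have hy := mem_range_smulIdem.1 y.2
        obtain ⟨c, hc⟩ := hker y z hy hz (hcon y hy) (hcon z hz) hz0
        exact ⟨c, Subtype.ext hc.symm⟩
      · push Not at hz
        refine finrank_le_one 0 fun y => ⟨0, Subtype.ext ?_⟩
        rw [hz y (mem_range_smulIdem.1 y.2), smul_zero]
        rfl
    have : dimv cartanD4 sgn M 1 ≤ 1 := hfr
    omega
  have hαβ : ∀ i : Fin 4, i ≠ 1 → ∀ u : M, 𝖺 sgn 1 i • 𝖺 sgn i 1 • u = 0 := fun i hi u => by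
    rw [smul_smul, pa_one_mul_pa hsgn hi, zero_smul]
  refine ⟨v, hv, hv2, fun y hy hy2 => ?_, fun u => h32 _ (hαβ 3 (by decide) u)⟩
  obtain ⟨c, hc⟩ := hker y (𝖺 sgn 2 1 • 𝖺 sgn 1 2 • v) hy (he _ _ _) hy2 (hαβ 2 (by decide) _)
    (fun h => hv2 (hM.eq_zero_of_pa_smul 2 (by decide) _ (he _ _ _) h))
  exact ⟨c • 𝖺 sgn 1 2 • v, by rw [hc, smul_comm (𝖺 sgn 2 1) c]⟩

end Structure
theorem pa_smul_eq_zero_of_pe_smul {S : Type} [AddCommGroup S]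
    [Module (Λ₄ sgn) S] {k : Fin 4} (hS : ∀ x : S, 𝖾 sgn k • x = x) (i j : Fin 4)
    (x : S) : 𝖺 sgn i j • x = 0 := by
  by_cases hi : i = k
  · subst hi
    by_cases hj : j = i
    · rw [hj, pa_eq_zero (by simp [cartanD4]), zero_smul]
    · rw [← hS (𝖺 sgn i j • x), smul_smul, pe_mul_pa_of_ne (Ne.symm hj), zero_smul]
  · rw [← hS x, smul_smul, pa_mul_pe_of_ne (Ne.symm hi), zero_smul]

section Hom

variable {M : Type}
  [AddCommGroup M] [Module ℂ M] [Module (Λ₄ sgn) M] [SMulCommClass (Λ₄ sgn) ℂ M]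

theorem exists_functional_eq_one {v : M} (hv : v ≠ 0) : ∃ ψ : M →ₗ[ℂ] ℂ, ψ v = 1 := by
  obtain ⟨φ, hφ⟩ : ∃ φ : Module.Dual ℂ M, φ v ≠ 0 := by
    by_contra! h
    exact hv ((Module.forall_dual_apply_eq_zero_iff ℂ v).1 h)
  exact ⟨(φ v)⁻¹ • φ, inv_mul_cancel₀ hφ⟩

/-- A homomorphism that kills a generator of the vertex space at `1` modulo the kernel of the
arrow `1 → 2` kills that vertex space, provided it kills the vertex space at `2`. -/
theorem hom_eq_zero_vertex_one {X : Type} [AddCommGroup X] [Module ℂ X]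
    [Module (Λ₄ sgn) X] [IsScalarTower ℂ (Λ₄ sgn) M]
    [IsScalarTower ℂ (Λ₄ sgn) X]
    (h2 : dimv cartanD4 sgn M 2 = 1) {v : M} (hv : 𝖾 sgn 1 • v = v) (hv2 : 𝖺 sgn 1 2 • v ≠ 0)
    (hker : ∀ y : M, 𝖾 sgn 1 • y = y → 𝖺 sgn 1 2 • y = 0 → ∃ u : M, y = 𝖺 sgn 2 1 • u)
    (g : M →ₗ[Λ₄ sgn] X) (hX2 : ∀ x : X, 𝖾 sgn 2 • x = 0) (hg : g v = 0) (y : M)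
    (hy : 𝖾 sgn 1 • y = y) : g y = 0 := by
  have he : ∀ z : M, 𝖾 sgn 2 • 𝖺 sgn 1 2 • z = 𝖺 sgn 1 2 • z := fun z => by
    rw [smul_smul, pe_mul_pa]
  obtain ⟨c, hc⟩ := exists_smul_eq_of_finrank_one h2 (he y) (he v) hv2
  obtain ⟨u, hu⟩ := hker (y - c • v) (by rw [smul_sub, hy, smul_comm, hv])
    (by rw [smul_sub, smul_comm, hc, sub_self])
  have h : g (y - c • v) = 0 := by
    rw [hu, map_smul, ← pa_mul_pe, mul_smul, hX2, smul_zero]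
  rwa [map_sub, hom_map_smul_complex, hg, smul_zero, sub_zero] at h

theorem HasCentralSocle.hom_eq_zero {S : Type} [AddCommGroup S]
    [Module (Λ₄ sgn) S]
    (hM : HasCentralSocle (sgn := sgn) M) (h1 : dimv cartanD4 sgn M 1 = 2)
    (h0 : dimv cartanD4 sgn M 0 = 2) (hS1 : ∀ x : S, 𝖾 sgn 1 • x = x)
    (g : M →ₗ[Λ₄ sgn] S) : g = 0 := by
  refine hom_eq_zero_of_pe g fun i y hy => ?_
  by_cases hi : i = 1
  · subst hi
    obtain ⟨u, -, hu⟩ := hM.exists_pa_zero_one_smul h1 h0 hy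
    rw [← hu, map_smul, pa_smul_eq_zero_of_pe_smul hS1]
  · rw [← hS1 (g y), ← hy, ← map_smul, smul_smul, pe_mul_pe, if_neg (Ne.symm hi), zero_smul,
      map_zero]

variable {S X : Type}
  [AddCommGroup S] [Module ℂ S] [Module (Λ₄ sgn) S] [SMulCommClass (Λ₄ sgn) ℂ S]
  [AddCommGroup X] [Module ℂ X] [Module (Λ₄ sgn) X] [SMulCommClass (Λ₄ sgn) ℂ X]

theorem finrank_hom_eq_one_of_simple [IsScalarTower ℂ (Λ₄ sgn) M] [IsScalarTower ℂ (Λ₄ sgn) S]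
    (hsgn : ∀ i j, cartanD4 i j = -1 →
      sgn i j * sgn j i = -1 ∧ (sgn i j = 1 ∨ sgn i j = -1))
    (hM : HasCentralSocle (sgn := sgn) M) (h0 : dimv cartanD4 sgn M 0 = 0)
    (h1 : dimv cartanD4 sgn M 1 = 2) (h2 : dimv cartanD4 sgn M 2 = 1)
    (hS : finrank ℂ S = 1) (hS1 : ∀ x : S, 𝖾 sgn 1 • x = x) :
    finrank ℂ (M →ₗ[Λ₄ sgn] S) = 1 := by
  have hM0 : ∀ y : M, 𝖾 sgn 0 • y = 0 := fun y =>
    hM.pe_zero_smul_eq_zero h1 h0 (by rw [smul_smul, pe_mul_pe, if_pos rfl])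
  obtain ⟨v, hv, hv2, hker, h3⟩ := hM.exists_generator hsgn h1
    (fun y => by rw [← pe_mul_pa, mul_smul, hM0])
  have : Nontrivial S := Module.nontrivial_of_finrank_pos (R := ℂ) (by omega)
  obtain ⟨s, hs⟩ := exists_ne (0 : S)
  obtain ⟨ψ, hψ⟩ := exists_functional_eq_one hv2
  have hS0 : ∀ i, i ≠ 1 → ∀ x : S, 𝖾 sgn i • x = 0 := fun i hi x => by
    rw [← hS1 x, smul_smul, pe_mul_pe, if_neg hi, zero_smul]
  have hz : ∀ (i j : Fin 4) (x : M), 𝖺 sgn 1 2 • 𝖺 sgn i j • x = 0 := by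
    intro i j x
    by_cases hj : j = 1
    · subst hj
      match i with
      | 0 => rw [← pa_mul_pe 0 1, mul_smul, hM0, smul_zero, smul_zero]
      | 1 => rw [pa_one_one, zero_smul, smul_zero]
      | 2 => rw [smul_smul, pa_one_mul_pa hsgn (by decide), zero_smul]
      | 3 => exact h3 x
    · rw [smul_smul, pa_mul_pa_of_ne hj, zero_smul]
  let f : M →ₗ[Λ₄ sgn] S := homOfGenerators
    ((ψ ∘ₗ DistribSMul.toLinearMap ℂ M (𝖺 sgn 1 2)).smulRight s)
    (fun i x => by
      change ψ (𝖺 sgn 1 2 • 𝖾 sgn i • x) • s = 𝖾 sgn i • ψ (𝖺 sgn 1 2 • x) • s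
      by_cases hi : i = 1
      · rw [hi, hS1, smul_smul, pa_mul_pe]
      · rw [smul_smul, pa_mul_pe_of_ne hi, hS0 i hi, zero_smul, map_zero, zero_smul])
    (fun i j x => by
      change ψ (𝖺 sgn 1 2 • 𝖺 sgn i j • x) • s = 𝖺 sgn i j • ψ (𝖺 sgn 1 2 • x) • s
      rw [hz, map_zero, zero_smul, pa_smul_eq_zero_of_pe_smul hS1])
  have hfv : f v = s := by
    change ψ (𝖺 sgn 1 2 • v) • s = s
    rw [hψ, one_smul]
  refine finrank_eq_one f (fun h => hs (by rw [← hfv, h, LinearMap.zero_apply])) fun g => ?_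
  obtain ⟨c, hc⟩ := (finrank_eq_one_iff_of_nonzero' s hs).1 hS (g v)
  refine ⟨c, (sub_eq_zero.1 (hom_eq_zero_of_pe (g - c • f) fun i y hy => ?_)).symm⟩
  by_cases hi : i = 1
  · subst hi
    refine hom_eq_zero_vertex_one h2 hv hv2 hker _ (hS0 2 (by decide)) ?_ y hy
    rw [LinearMap.sub_apply, LinearMap.smul_apply, hfv, hc, sub_self]
  · rw [← hy, map_smul, hS0 i hi]

/-- The `Λ`-module `X` is uniserial of length two with top at the vertex `0`, generated by `x`,
and socle at the vertex `1`. -/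
structure IsUniserialZeroOne (x : X) : Prop where
  pe_smul : 𝖾 sgn 0 • x = x
  pa_smul_ne_zero : 𝖺 sgn 0 1 • x ≠ 0
  pe_two : ∀ y : X, 𝖾 sgn 2 • y = 0
  pe_three : ∀ y : X, 𝖾 sgn 3 • y = 0
  exists_smul_eq : ∀ y : X, 𝖾 sgn 0 • y = y → ∃ c : ℂ, y = c • x

theorem exists_isUniserialZeroOne {B S₀ : Type} [AddCommGroup B] [Module (Λ₄ sgn) B]
    [AddCommGroup S₀] [Module ℂ S₀] [Module (Λ₄ sgn) S₀]
    [IsScalarTower ℂ (Λ₄ sgn) S₀] [IsScalarTower ℂ (Λ₄ sgn) X]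
    (hS₀ : finrank ℂ S₀ = 1) (hS₀0 : ∀ x : S₀, 𝖾 sgn 0 • x = x)
    (hB1 : ∀ x : B, 𝖾 sgn 1 • x = x)
    (ι : B →ₗ[Λ₄ sgn] X) (π : X →ₗ[Λ₄ sgn] S₀) (hπ : Function.Surjective π)
    (hex : LinearMap.range ι = LinearMap.ker π)
    (hns : ¬ ∃ σ : S₀ →ₗ[Λ₄ sgn] X, π.comp σ = LinearMap.id) :
    ∃ x : X, IsUniserialZeroOne (sgn := sgn) x := by
  have : Nontrivial S₀ := Module.nontrivial_of_finrank_pos (R := ℂ) (by omega)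
  obtain ⟨s, hs⟩ := exists_ne (0 : S₀)
  obtain ⟨y, hy⟩ := hπ s
  have hspan := (finrank_eq_one_iff_of_nonzero' s hs).1 hS₀
  have hker : ∀ i, i ≠ 1 → ∀ z : X, π z = 0 → 𝖾 sgn i • z = 0 := by
    intro i hi z hz
    obtain ⟨t, rfl⟩ : z ∈ LinearMap.range ι := hex ▸ LinearMap.mem_ker.2 hz
    rw [← map_smul, ← hB1 t, smul_smul, pe_mul_pe, if_neg hi, zero_smul, map_zero]
  have hS₀i : ∀ i, i ≠ 0 → ∀ t : S₀, 𝖾 sgn i • t = 0 := fun i hi t => by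
    rw [← hS₀0 t, smul_smul, pe_mul_pe, if_neg hi, zero_smul]
  have hkill : ∀ i, i ≠ 0 → i ≠ 1 → ∀ z : X, 𝖾 sgn i • z = 0 := by
    intro i hi0 hi1 z
    have h := hker i hi1 (𝖾 sgn i • z) (by rw [map_smul, hS₀i i hi0])
    rwa [smul_smul, pe_mul_pe, if_pos rfl] at h
  have hx : 𝖾 sgn 0 • 𝖾 sgn 0 • y = 𝖾 sgn 0 • y := by rw [smul_smul, pe_mul_pe, if_pos rfl]
  have hπx : π (𝖾 sgn 0 • y) = s := by rw [map_smul, hy, hS₀0]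
  refine ⟨𝖾 sgn 0 • y, hx, fun h0 => hns ?_, hkill 2 (by decide) (by decide),
    hkill 3 (by decide) (by decide), fun z hz => ?_⟩
  · have hkill' : ∀ i j, 𝖺 sgn i j • 𝖾 sgn 0 • y = 0 := by
      intro i j
      by_cases hi : i = 0
      · subst hi
        by_cases hj : j = 1
        · rw [hj, h0]
        · rw [pa_eq_zero_of_ne_one (by decide) hj, zero_smul]
      · rw [smul_smul, pa_mul_pe_of_ne (Ne.symm hi), zero_smul]
    obtain ⟨ψ, hψ⟩ := exists_functional_eq_one hs
    refine ⟨homOfGenerators (ψ.smulRight (𝖾 sgn 0 • y)) (fun i t => ?_) (fun i j t => ?_), ?_⟩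
    · change ψ (𝖾 sgn i • t) • 𝖾 sgn 0 • y = 𝖾 sgn i • ψ t • 𝖾 sgn 0 • y
      by_cases hi : i = 0
      · rw [hi, hS₀0, smul_comm (𝖾 sgn 0) (ψ t), hx]
      · rw [hS₀i i hi, map_zero, zero_smul, smul_comm, smul_smul, pe_mul_pe, if_neg hi,
          zero_smul, smul_zero]
    · change ψ (𝖺 sgn i j • t) • 𝖾 sgn 0 • y = 𝖺 sgn i j • ψ t • 𝖾 sgn 0 • y
      rw [pa_smul_eq_zero_of_pe_smul hS₀0, map_zero, zero_smul, smul_comm, hkill', smul_zero]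
    · ext t
      obtain ⟨c, rfl⟩ := hspan t
      change π (ψ (c • s) • 𝖾 sgn 0 • y) = c • s
      rw [hom_map_smul_complex, hπx, map_smul, hψ, smul_eq_mul, mul_one]
  · obtain ⟨c, hc⟩ := hspan (π z)
    have h := hker 0 (by decide) (z - c • 𝖾 sgn 0 • y)
      (by rw [map_sub, hom_map_smul_complex, hπx, hc, sub_self])
    rw [smul_sub, hz, smul_comm, hx] at h
    exact ⟨c, sub_eq_zero.1 h⟩

theorem finrank_hom_eq_one_of_isUniserialZeroOne
    [IsScalarTower ℂ (Λ₄ sgn) M] [IsScalarTower ℂ (Λ₄ sgn) X]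
    (hsgn : ∀ i j, cartanD4 i j = -1 →
      sgn i j * sgn j i = -1 ∧ (sgn i j = 1 ∨ sgn i j = -1))
    (hM : HasCentralSocle (sgn := sgn) M) (h0 : dimv cartanD4 sgn M 0 = 2)
    (h1 : dimv cartanD4 sgn M 1 = 2) (h2 : dimv cartanD4 sgn M 2 = 1)
    {x : X} (hx : IsUniserialZeroOne (sgn := sgn) x) :
    finrank ℂ (M →ₗ[Λ₄ sgn] X) = 1 := by
  have h010 : 𝖺 sgn 1 0 * 𝖺 sgn 0 1 = 0 := pa_one_mul_pa hsgn (by decide)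
  have hα : ∀ y : M, 𝖺 sgn 1 0 • y = 0 := by
    intro y
    obtain ⟨u, -, hu⟩ := hM.exists_pa_zero_one_smul (y := 𝖾 sgn 1 • y) h1 h0
      (by rw [smul_smul, pe_mul_pe, if_pos rfl])
    rw [← pa_mul_pe, mul_smul, ← hu, smul_smul, h010, zero_smul]
  obtain ⟨v, hv, hv2, hker, h3⟩ := hM.exists_generator hsgn h1 hα
  obtain ⟨w, hw, hwv⟩ := hM.exists_pa_zero_one_smul h1 h0 hv
  obtain ⟨ψ, hψ⟩ := exists_functional_eq_one hv2
  have hX : ∀ i, i ≠ 0 → i ≠ 1 → ∀ y : X, 𝖾 sgn i • y = 0 := by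
    intro i hi0 hi1 y
    match i with
    | 2 => exact hx.pe_two y
    | 3 => exact hx.pe_three y
  have hpx : ∀ i, i ≠ 0 → ∀ j, 𝖺 sgn i j • x = 0 := fun i hi j => by
    rw [← hx.pe_smul, smul_smul, pa_mul_pe_of_ne (Ne.symm hi), zero_smul]
  have hpx1 : ∀ i j, 𝖺 sgn i j • 𝖺 sgn 0 1 • x = 0 := by
    intro i j
    rw [smul_smul]
    by_cases hi : i = 1
    · subst hi
      by_cases hj0 : j = 0
      · rw [hj0, h010, zero_smul]
      · by_cases hj1 : j = 1
        · rw [hj1, pa_one_one, zero_mul, zero_smul]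
        · rw [← pe_mul_pa 1 j, mul_smul, mul_smul, hX j hj0 hj1]
    · rw [pa_mul_pa_of_ne (Ne.symm hi), zero_smul]
  have hz : ∀ i, i ≠ 0 → ∀ (j : Fin 4) (y : M), 𝖺 sgn 1 2 • 𝖺 sgn i j • y = 0 := by
    intro i hi j y
    by_cases hj : j = 1
    · subst hj
      match i with
      | 1 => rw [pa_one_one, zero_smul, smul_zero]
      | 2 => rw [smul_smul, pa_one_mul_pa hsgn (by decide), zero_smul]
      | 3 => exact h3 y
    · rw [smul_smul, pa_mul_pa_of_ne hj, zero_smul]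
  have hz0 : ∀ (i j : Fin 4) (y : M), 𝖺 sgn 0 1 • 𝖺 sgn i j • y = 0 := by
    intro i j y
    by_cases hj : j = 0
    · subst hj
      by_cases hi : i = 1
      · rw [hi, hα, smul_zero]
      · rw [pa_eq_zero_of_ne_one hi (by decide), zero_smul, smul_zero]
    · rw [smul_smul, pa_mul_pa_of_ne hj, zero_smul]
  let A : Module.End ℂ M := DistribSMul.toLinearMap ℂ M (𝖺 sgn 1 2)
  let B : Module.End ℂ M := DistribSMul.toLinearMap ℂ M (𝖺 sgn 0 1)
  let f : M →ₗ[Λ₄ sgn] X := homOfGenerators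
    ((ψ ∘ₗ A).smulRight (𝖺 sgn 0 1 • x) + (ψ ∘ₗ A ∘ₗ B).smulRight x)
    (fun i y => by
      change ψ (𝖺 sgn 1 2 • 𝖾 sgn i • y) • 𝖺 sgn 0 1 • x +
          ψ (𝖺 sgn 1 2 • 𝖺 sgn 0 1 • 𝖾 sgn i • y) • x =
        𝖾 sgn i • (ψ (𝖺 sgn 1 2 • y) • 𝖺 sgn 0 1 • x + ψ (𝖺 sgn 1 2 • 𝖺 sgn 0 1 • y) • x)
      rw [smul_add, smul_comm _ (ψ (𝖺 sgn 1 2 • y)),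
        smul_comm _ (ψ (𝖺 sgn 1 2 • 𝖺 sgn 0 1 • y)), smul_smul (𝖺 sgn 1 2) (𝖾 sgn i),
        smul_smul (𝖺 sgn 0 1) (𝖾 sgn i), smul_smul (𝖾 sgn i) (𝖺 sgn 0 1)]
      congr 1
      · by_cases hi : i = 1
        · rw [hi, pa_mul_pe, pe_mul_pa]
        · rw [pa_mul_pe_of_ne hi, pe_mul_pa_of_ne hi, zero_smul, zero_smul, map_zero, zero_smul,
            smul_zero]
      · by_cases hi : i = 0
        · rw [hi, pa_mul_pe, hx.pe_smul]
        · rw [← hx.pe_smul, smul_smul (𝖾 sgn i), pe_mul_pe, if_neg hi, pa_mul_pe_of_ne hi,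
            zero_smul, smul_zero, map_zero, zero_smul, zero_smul, smul_zero])
    (fun i j y => by
      change ψ (𝖺 sgn 1 2 • 𝖺 sgn i j • y) • 𝖺 sgn 0 1 • x +
          ψ (𝖺 sgn 1 2 • 𝖺 sgn 0 1 • 𝖺 sgn i j • y) • x =
        𝖺 sgn i j • (ψ (𝖺 sgn 1 2 • y) • 𝖺 sgn 0 1 • x + ψ (𝖺 sgn 1 2 • 𝖺 sgn 0 1 • y) • x)
      rw [smul_add, smul_comm _ (ψ (𝖺 sgn 1 2 • y)),
        smul_comm _ (ψ (𝖺 sgn 1 2 • 𝖺 sgn 0 1 • y)), hpx1, smul_zero, zero_add, hz0,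
        smul_zero, map_zero, zero_smul, add_zero]
      by_cases hi : i = 0
      · subst hi
        by_cases hj : j = 1
        · rw [hj]
        · rw [pa_eq_zero_of_ne_one (by decide) hj, zero_smul, zero_smul, smul_zero, map_zero,
            zero_smul, smul_zero]
      · rw [hz i hi, hpx i hi, map_zero, zero_smul, smul_zero])
  have hfw : f w = x := by
    change ψ (𝖺 sgn 1 2 • w) • 𝖺 sgn 0 1 • x + ψ (𝖺 sgn 1 2 • 𝖺 sgn 0 1 • w) • x = x
    rw [hwv, hψ, one_smul, ← hw, smul_smul, pa_mul_pe_of_ne (by decide), zero_smul, map_zero,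
      zero_smul, zero_add]
  have hx0 : x ≠ 0 := fun h => hx.pa_smul_ne_zero (by rw [h, smul_zero])
  refine finrank_eq_one f (fun h => hx0 (by rw [← hfw, h, LinearMap.zero_apply])) fun g => ?_
  obtain ⟨c, hc⟩ := hx.exists_smul_eq (g w) (by rw [← map_smul, hw])
  set d := g - c • f with hd
  have hdw : d w = 0 := by
    rw [hd, LinearMap.sub_apply, LinearMap.smul_apply, hfw, hc, sub_self]
  have hd1 : ∀ y, 𝖾 sgn 1 • y = y → d y = 0 := hom_eq_zero_vertex_one h2 hv hv2 hker d hx.pe_two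
    (by rw [← hwv, map_smul, hdw, smul_zero])
  refine ⟨c, (sub_eq_zero.1 (hom_eq_zero_of_pe d fun i y hy => ?_)).symm⟩
  by_cases hi1 : i = 1
  · subst hi1
    exact hd1 y hy
  by_cases hi0 : i = 0
  · subst hi0
    obtain ⟨b, hb⟩ := hx.exists_smul_eq (d y) (by rw [← map_smul, hy])
    have h := hd1 (𝖺 sgn 0 1 • y) (by rw [smul_smul, pe_mul_pa])
    rw [map_smul, hb, smul_comm, smul_eq_zero] at h
    rw [hb, h.resolve_right hx.pa_smul_ne_zero, zero_smul]
  · rw [← hy, map_smul, hX i hi0 hi1]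

end Hom

end D4

/-- Homomorphisms into a direct sum. -/
def homProdEquiv {C sgn : I → I → ℤ} {M T A B : Type}
    [AddCommGroup M] [Module (PreprojAlg C sgn) M]
    [AddCommGroup T] [Module (PreprojAlg C sgn) T] [Module ℂ T]
    [SMulCommClass (PreprojAlg C sgn) ℂ T] [IsScalarTower ℂ (PreprojAlg C sgn) T]
    [AddCommGroup A] [Module (PreprojAlg C sgn) A] [Module ℂ A]
    [SMulCommClass (PreprojAlg C sgn) ℂ A] [IsScalarTower ℂ (PreprojAlg C sgn) A]
    [AddCommGroup B] [Module (PreprojAlg C sgn) B] [Module ℂ B]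
    [SMulCommClass (PreprojAlg C sgn) ℂ B] [IsScalarTower ℂ (PreprojAlg C sgn) B]
    (eq : T ≃ₗ[PreprojAlg C sgn] (A × B)) :
    (M →ₗ[PreprojAlg C sgn] T) ≃ₗ[ℂ]
      (M →ₗ[PreprojAlg C sgn] A) × (M →ₗ[PreprojAlg C sgn] B) where
  toFun f := ((LinearMap.fst _ A B).comp (eq.toLinearMap.comp f),
    (LinearMap.snd _ A B).comp (eq.toLinearMap.comp f))
  invFun p := eq.symm.toLinearMap.comp (p.1.prod p.2)
  map_add' f g := by ext <;> simp
  map_smul' c f := by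
    have h : ∀ t : T, eq (c • t) = c • eq t := hom_map_smul_complex eq.toLinearMap c
    ext <;> simp [h]
  left_inv f := by
    ext x
    exact eq.symm_apply_apply (f x)
  right_inv p := by
    ext x <;> simp

/-!
STATEMENT 17.  Let `Λ` be the preprojective algebra of type `D₄` (central vertex `1` in
our 0-indexed labels), `T = S₂ ⊕ S₂` and `T' = X ⊕ S₂`, where `X` is the unique nonsplit
extension of `S₁` by `S₂` (vertices `0` and `1` here).  Let `γ₀ = −s₁s₂s₄s₃s₂ϖ₂`, so
`⟨h₁, γ₀⟩ = 2`; `N(γ₀)` and `N(s₁γ₀)` are the unique submodules of the injective hull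
`I₂` of `S₂` with dimension vectors `2α₁ + 2α₂ + α₃ + α₄` and `2α₂ + α₃ + α₄`
respectively.  Then `dim Hom_Λ(N(γ₀), T) = 0`, `dim Hom_Λ(N(s₁γ₀), T) = 2` and
`dim Hom_Λ(N(γ₀), T') = 1`; in particular
`−dim Hom(N(γ₀),T') ≠ min {−dim Hom(N(γ₀),T), −dim Hom(N(s₁γ₀),T) + c·2}` with `c = 1`.
-/
theorem stmt_17
    (sgn : Fin 4 → Fin 4 → ℤ)
    (hsgn : ∀ i j, cartanD4 i j = -1 →
      sgn i j * sgn j i = -1 ∧ (sgn i j = 1 ∨ sgn i j = -1))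
    -- the simple modules `S₁` (vertex 0) and `S₂` (vertex 1):
    (S₁ S₂ : Type)
    [AddCommGroup S₁] [Module (PreprojAlg cartanD4 sgn) S₁] [Module ℂ S₁]
    [SMulCommClass (PreprojAlg cartanD4 sgn) ℂ S₁]
    [IsScalarTower ℂ (PreprojAlg cartanD4 sgn) S₁]
    [AddCommGroup S₂] [Module (PreprojAlg cartanD4 sgn) S₂] [Module ℂ S₂]
    [SMulCommClass (PreprojAlg cartanD4 sgn) ℂ S₂]
    [IsScalarTower ℂ (PreprojAlg cartanD4 sgn) S₂]
    (hS₁1 : finrank ℂ S₁ = 1) (hS₁0 : ∀ x : S₁, pe cartanD4 sgn 0 • x = x)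
    (hS₂1 : finrank ℂ S₂ = 1) (hS₂1' : ∀ x : S₂, pe cartanD4 sgn 1 • x = x)
    -- `X`, the unique nonsplit extension of `S₁` by `S₂`:
    (X : Type)
    [AddCommGroup X] [Module (PreprojAlg cartanD4 sgn) X] [Module ℂ X]
    [SMulCommClass (PreprojAlg cartanD4 sgn) ℂ X]
    [IsScalarTower ℂ (PreprojAlg cartanD4 sgn) X]
    (ιX : S₂ →ₗ[PreprojAlg cartanD4 sgn] X) (πX : X →ₗ[PreprojAlg cartanD4 sgn] S₁)
    (hιX : Function.Injective ιX) (hπX : Function.Surjective πX)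
    (hexX : LinearMap.range ιX = LinearMap.ker πX)
    (hnonsplit : ¬ ∃ σ : S₁ →ₗ[PreprojAlg cartanD4 sgn] X, πX.comp σ = LinearMap.id)
    -- `T = S₂ ⊕ S₂` and `T' = X ⊕ S₂`:
    (T T' : Type)
    [AddCommGroup T] [Module (PreprojAlg cartanD4 sgn) T] [Module ℂ T]
    [SMulCommClass (PreprojAlg cartanD4 sgn) ℂ T]
    [IsScalarTower ℂ (PreprojAlg cartanD4 sgn) T]
    [AddCommGroup T'] [Module (PreprojAlg cartanD4 sgn) T'] [Module ℂ T']
    [SMulCommClass (PreprojAlg cartanD4 sgn) ℂ T']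
    [IsScalarTower ℂ (PreprojAlg cartanD4 sgn) T']
    (eT : T ≃ₗ[PreprojAlg cartanD4 sgn] (S₂ × S₂))
    (eT' : T' ≃ₗ[PreprojAlg cartanD4 sgn] (X × S₂))
    -- `II = I₂`, the injective hull of `S₂`:
    (II : Type)
    [AddCommGroup II] [Module (PreprojAlg cartanD4 sgn) II] [Module ℂ II]
    [SMulCommClass (PreprojAlg cartanD4 sgn) ℂ II]
    [IsScalarTower ℂ (PreprojAlg cartanD4 sgn) II]
    (hinj : Module.Injective (PreprojAlg cartanD4 sgn) II)
    (ιS : S₂ →ₗ[PreprojAlg cartanD4 sgn] II) (hιS : Function.Injective ιS)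
    (hess : ∀ y : II, y ≠ 0 → ∃ a : PreprojAlg cartanD4 sgn,
      a • y ≠ 0 ∧ a • y ∈ LinearMap.range ιS)
    -- `N₀ = N(γ₀)` and `N₁ = N(s₁γ₀)`, the unique submodules of `I₂` with dimension
    -- vectors `(2,2,1,1)` and `(0,2,1,1)` respectively:
    (N₀ N₁ : Type)
    [AddCommGroup N₀] [Module (PreprojAlg cartanD4 sgn) N₀] [Module ℂ N₀]
    [SMulCommClass (PreprojAlg cartanD4 sgn) ℂ N₀]
    [IsScalarTower ℂ (PreprojAlg cartanD4 sgn) N₀]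
    [AddCommGroup N₁] [Module (PreprojAlg cartanD4 sgn) N₁] [Module ℂ N₁]
    [SMulCommClass (PreprojAlg cartanD4 sgn) ℂ N₁]
    [IsScalarTower ℂ (PreprojAlg cartanD4 sgn) N₁]
    (ι₀ : N₀ →ₗ[PreprojAlg cartanD4 sgn] II) (hι₀ : Function.Injective ι₀)
    (hd₀ : ∀ i, dimv cartanD4 sgn N₀ i = ![2, 2, 1, 1] i)
    (huniq₀ : ∀ (N : Type) [AddCommGroup N] [Module (PreprojAlg cartanD4 sgn) N]
      [Module ℂ N] [SMulCommClass (PreprojAlg cartanD4 sgn) ℂ N],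
      ∀ f : N →ₗ[PreprojAlg cartanD4 sgn] II, Function.Injective f →
        (∀ i, dimv cartanD4 sgn N i = ![2, 2, 1, 1] i) →
        LinearMap.range f = LinearMap.range ι₀)
    (ι₁ : N₁ →ₗ[PreprojAlg cartanD4 sgn] II) (hι₁ : Function.Injective ι₁)
    (hd₁ : ∀ i, dimv cartanD4 sgn N₁ i = ![0, 2, 1, 1] i)
    (huniq₁ : ∀ (N : Type) [AddCommGroup N] [Module (PreprojAlg cartanD4 sgn) N]
      [Module ℂ N] [SMulCommClass (PreprojAlg cartanD4 sgn) ℂ N],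
      ∀ f : N →ₗ[PreprojAlg cartanD4 sgn] II, Function.Injective f →
        (∀ i, dimv cartanD4 sgn N i = ![0, 2, 1, 1] i) →
        LinearMap.range f = LinearMap.range ι₁) :
    finrank ℂ (N₀ →ₗ[PreprojAlg cartanD4 sgn] T) = 0 ∧
    finrank ℂ (N₁ →ₗ[PreprojAlg cartanD4 sgn] T) = 2 ∧
    finrank ℂ (N₀ →ₗ[PreprojAlg cartanD4 sgn] T') = 1 ∧
    -(finrank ℂ (N₀ →ₗ[PreprojAlg cartanD4 sgn] T') : ℤ) ≠
      min (-(finrank ℂ (N₀ →ₗ[PreprojAlg cartanD4 sgn] T) : ℤ))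
        (-(finrank ℂ (N₁ →ₗ[PreprojAlg cartanD4 sgn] T) : ℤ) + 1 * 2) := by
  have hN₀ := hasCentralSocle_of_injective hS₂1 hS₂1' ιS hess ι₀ hι₀
  have hN₁ := hasCentralSocle_of_injective hS₂1 hS₂1' ιS hess ι₁ hι₁
  have hzero : Subsingleton (N₀ →ₗ[PreprojAlg cartanD4 sgn] S₂) :=
    subsingleton_of_forall_eq 0 (hN₀.hom_eq_zero (hd₀ 1) (hd₀ 0) hS₂1')
  have hone := finrank_hom_eq_one_of_simple hsgn hN₁ (hd₁ 0) (hd₁ 1) (hd₁ 2) hS₂1 hS₂1'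
  obtain ⟨x, hx⟩ := exists_isUniserialZeroOne hS₁1 hS₁0 hS₂1' ιX πX hπX hexX hnonsplit
  have hX := finrank_hom_eq_one_of_isUniserialZeroOne hsgn hN₀ (hd₀ 0) (hd₀ 1) (hd₀ 2) hx
  have := FiniteDimensional.of_finrank_pos (hone.symm ▸ Nat.one_pos)
  have := FiniteDimensional.of_finrank_pos (hX.symm ▸ Nat.one_pos)
  have h₀T : finrank ℂ (N₀ →ₗ[PreprojAlg cartanD4 sgn] T) = 0 := by
    rw [(homProdEquiv eT).finrank_eq, finrank_zero_of_subsingleton]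
  have h₁T : finrank ℂ (N₁ →ₗ[PreprojAlg cartanD4 sgn] T) = 2 := by
    rw [(homProdEquiv eT).finrank_eq, finrank_prod, hone]
  have h₀T' : finrank ℂ (N₀ →ₗ[PreprojAlg cartanD4 sgn] T') = 1 := by
    rw [(homProdEquiv eT').finrank_eq, finrank_prod, hX, finrank_zero_of_subsingleton]
  refine ⟨h₀T, h₁T, h₀T', ?_⟩
  rw [h₀T, h₁T, h₀T']
  decide
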